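/- Let X be a compact topological space equipped with its Borel σ-algebra, and let V be a finite-dimensional ℂ-linear subspace of the space of continuous functions X → ℂ such that: (i) V has no common zero, i.e. for every x ∈ X there is f ∈ V with f(x) ≠ 0; and (ii) V is minimal with this property, i.e. every proper ℂ-linear subspace W ⊊ V has a common zero (there exists x ∈ X with g(x) = 0 for all g ∈ W). Then for every positive definite hermitian inner product ⟨·,·⟩ on V there exists a finite Borel measure μ on X such that ⟨f, g⟩ = ∫_X f(x) · conj(g(x)) dμ(x) for all f, g ∈ V. -/

import Mathlib

open MeasureTheory

/-- A positive definite hermitian form on a finite-dimensional complex vector space is a sum of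
squares of nonzero linear functionals. -/
theorem exists_sum_functional_mul_conj {V : Type*} [AddCommGroup V] [Module ℂ V]
    [FiniteDimensional ℂ V] (B : V → V → ℂ)
    (hlin : ∀ g : V, IsLinearMap ℂ fun f : V => B f g)
    (hsymm : ∀ f g : V, B g f = (starRingEnd ℂ) (B f g))
    (hpos : ∀ f : V, f ≠ 0 → 0 < (B f f).re) :
    ∃ (n : ℕ) (φ : Fin n → V →ₗ[ℂ] ℂ), (∀ i, φ i ≠ 0) ∧
      ∀ f g : V, B f g = ∑ i, φ i f * (starRingEnd ℂ) (φ i g) := by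
  have hzero : B 0 0 = 0 := (hlin 0).map_zero
  let core : InnerProductSpace.Core ℂ V :=
    { inner := fun f g => B g f
      conj_inner_symm := fun f g => (hsymm f g).symm
      re_inner_nonneg := fun f => by
        by_cases hf : f = 0
        · subst hf
          simp [hzero]
        · exact (hpos f hf).le
      add_left := fun f g h => by
        change B h (f + g) = B h f + B h g
        rw [hsymm (f + g) h, (hlin h).map_add, map_add, ← hsymm, ← hsymm]
      smul_left := fun f g r => by
        change B g (r • f) = (starRingEnd ℂ) r * B g f
        rw [hsymm (r • f) g, (hlin g).map_smul, smul_eq_mul, map_mul, ← hsymm]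
      definite := fun f hf => by
        by_contra hne
        have h := hpos f hne
        change B f f = 0 at hf
        simp [hf] at h }
  let _ : NormedAddCommGroup V := core.toNormedAddCommGroup
  let _ : InnerProductSpace ℂ V := InnerProductSpace.ofCore core.toCore
  have hinner : ∀ f g : V, inner ℂ f g = B g f := fun _ _ => rfl
  let b := stdOrthonormalBasis ℂ V
  refine ⟨_, fun i => (hlin (b i)).mk' _, fun i hi => ?_, fun f g => ?_⟩
  · have h : B (b i) (b i) = 0 := LinearMap.congr_fun hi (b i)
    exact b.orthonormal.ne_zero i (inner_self_eq_zero (𝕜 := ℂ).mp h)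
  · rw [← hinner g f, ← b.sum_inner_mul_inner]
    refine Finset.sum_congr rfl fun i _ => ?_
    rw [hinner, hinner, IsLinearMap.mk'_apply, IsLinearMap.mk'_apply, ← hsymm, mul_comm]

/-- If `V` has no common zero but each of its proper subspaces does, then every nonzero functional
on `V` is a multiple of an evaluation. -/
theorem exists_eq_mul_eval {X : Type*} [TopologicalSpace X] (V : Submodule ℂ C(X, ℂ))
    (hgen : ∀ x : X, ∃ f ∈ V, f x ≠ 0)
    (hmin : ∀ W : Submodule ℂ C(X, ℂ), W < V → ∃ x : X, ∀ g ∈ W, g x = 0)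
    (φ : V →ₗ[ℂ] ℂ) (hφ : φ ≠ 0) :
    ∃ (x : X) (c : ℂ), ∀ f : V, φ f = c * (f : C(X, ℂ)) x := by
  have hlt : (LinearMap.ker φ).map V.subtype < V := by
    refine lt_of_le_of_ne (Submodule.map_subtype_le _ _) fun h => hφ ?_
    ext f
    have hf : (f : C(X, ℂ)) ∈ (LinearMap.ker φ).map V.subtype := h.ge f.2
    obtain ⟨f', hf', hff⟩ := hf
    obtain rfl : f' = f := Subtype.ext hff
    exact hf'
  obtain ⟨x, hx⟩ := hmin _ hlt
  obtain ⟨e, he, hex⟩ := hgen x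
  have hker : ∀ f : V, φ f = 0 → (f : C(X, ℂ)) x = 0 := fun f hf => hx _ ⟨f, hf, rfl⟩
  obtain ⟨u, hu⟩ : ∃ u : V, φ u ≠ 0 := ⟨⟨e, he⟩, fun h => hex (hker _ h)⟩
  have heval : ∀ f : V, φ u * (f : C(X, ℂ)) x = φ f * (u : C(X, ℂ)) x := fun f => by
    have h := hker (φ u • f + (-φ f) • u) (by simp [mul_comm])
    rw [← sub_eq_zero, sub_eq_add_neg, ← neg_mul]
    simpa using h
  have hux : (u : C(X, ℂ)) x ≠ 0 := fun h => by
    have := heval ⟨e, he⟩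
    simp [h, hu, hex] at this
  refine ⟨x, φ u / (u : C(X, ℂ)) x, fun f => ?_⟩
  rw [div_mul_eq_mul_div, heval, mul_div_cancel_right₀ _ hux]

/-- measure-theoretic form of the paper's Theorem 1.2: if `V` is a
finite-dimensional subspace of `C(X, ℂ)` with no common zero, minimal with this
property, then every positive definite hermitian inner product on `V` is realized by
integration against some finite Borel measure. -/
theorem stmt_3 {X : Type*} [TopologicalSpace X] [CompactSpace X]
    [MeasurableSpace X] [BorelSpace X]
    (V : Submodule ℂ C(X, ℂ)) (hV : FiniteDimensional ℂ V)
    (hgen : ∀ x : X, ∃ f ∈ V, f x ≠ 0)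
    (hmin : ∀ W : Submodule ℂ C(X, ℂ), W < V → ∃ x : X, ∀ g ∈ W, g x = 0)
    (B : V → V → ℂ)
    (hlin : ∀ g : V, IsLinearMap ℂ fun f : V => B f g)
    (hsymm : ∀ f g : V, B g f = (starRingEnd ℂ) (B f g))
    (hpos : ∀ f : V, f ≠ 0 → 0 < (B f f).re) :
    ∃ μ : Measure X, IsFiniteMeasure μ ∧
      ∀ f g : V, B f g = ∫ x, (f : C(X, ℂ)) x * (starRingEnd ℂ) ((g : C(X, ℂ)) x) ∂μ := by
  obtain ⟨n, φ, hφ, hB⟩ := exists_sum_functional_mul_conj B hlin hsymm hpos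
  choose x c hc using fun i => exists_eq_mul_eval V hgen hmin (φ i) (hφ i)
  have hsm : ∀ f g : V, StronglyMeasurable
      fun y => (f : C(X, ℂ)) y * (starRingEnd ℂ) ((g : C(X, ℂ)) y) := fun f g =>
    Continuous.stronglyMeasurable (by fun_prop)
  refine ⟨∑ i, (‖c i‖₊ ^ 2) • Measure.dirac (x i), inferInstance, fun f g => ?_⟩
  rw [hB, integral_finsetSum_measure]
  · refine Finset.sum_congr rfl fun i _ => ?_
    rw [integral_smul_nnreal_measure, integral_dirac' _ _ (hsm f g), hc, hc, map_mul,
      NNReal.smul_def, Complex.real_smul, mul_mul_mul_comm, Complex.mul_conj']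
    simp
  · exact fun i _ => Integrable.smul_measure_nnreal
      (integrable_dirac' (hsm f g) enorm_lt_top)
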